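/- arXiv:2312.10388 — 2 statements merged into one kernel-verified Lean document; each statement's English description precedes it below -/
import Mathlib

section
/- Let (Ω, 𝒜, P) be a probability space and let 𝒴 : Ω → 𝒫(ℝ) be a measurable map into the space of Borel probability measures on ℝ (equipped with the Borel σ-algebra of the topology of weak convergence), with E[∫ x² d(𝒴(ω))(x)] < ∞. Then there exists a Borel probability measure μ* on ℝ with finite second moment whose quantile function satisfies Q_{μ*}(t) = E[Q_{𝒴(·)}(t)] for almost every t ∈ (0,1), and for every Borel probability measure ν on ℝ with finite second moment, E[W₂²(𝒴, ν)] ≥ E[W₂²(𝒴, μ*)], with equality if and only if ν = μ*. In other words, μ* is the unique 2-Wasserstein barycenter of the distribution-valued random variable 𝒴, and its quantile function is the pointwise expectation of the quantile functions of 𝒴. -/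
open MeasureTheory

/-- The quantile function of a Borel probability measure on `ℝ`:
`Q_μ(t) = inf {x : t ≤ μ((-∞, x])}`. -/
noncomputable def quantileFun (μ : Measure ℝ) (t : ℝ) : ℝ :=
  sInf {x : ℝ | ENNReal.ofReal t ≤ μ (Set.Iic x)}

/-- The squared 2-Wasserstein distance between two Borel probability measures on `ℝ`:
the infimum of `∫ (x − y)² dγ` over couplings `γ` of `μ` and `ν`. -/
noncomputable def wasserstein2Sq (μ ν : Measure ℝ) : ℝ :=
  sInf {c : ℝ | ∃ γ : Measure (ℝ × ℝ), IsProbabilityMeasure γ ∧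
    γ.fst = μ ∧ γ.snd = ν ∧ c = ∫ p : ℝ × ℝ, (p.1 - p.2) ^ 2 ∂γ}

namespace WB

open MeasureTheory ProbabilityTheory Filter Topology

noncomputable abbrev lam : Measure ℝ := volume.restrict (Set.Ioo (0 : ℝ) 1)

instance : IsProbabilityMeasure lam := ⟨by simp [lam]⟩

open Classical in
noncomputable def G (μ : Measure ℝ) (t : ℝ) : ℝ :=
  if t ∈ Set.Ioo (0 : ℝ) 1 then quantileFun μ t else 0

lemma G_eq {μ : Measure ℝ} {t : ℝ} (ht : t ∈ Set.Ioo (0 : ℝ) 1) : G μ t = quantileFun μ t := by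
  simp only [G, if_pos ht]

lemma G_le_iff (μ : Measure ℝ) [IsProbabilityMeasure μ] {t : ℝ} (ht : t ∈ Set.Ioo (0 : ℝ) 1)
    (x : ℝ) : G μ t ≤ x ↔ t ≤ cdf μ x := by
  rw [G_eq ht]
  have hset : {x : ℝ | ENNReal.ofReal t ≤ μ (Set.Iic x)} = {x : ℝ | t ≤ cdf μ x} := by
    ext y
    simp only [Set.mem_ofPred_eq]
    rw [← ofReal_cdf μ y, ENNReal.ofReal_le_ofReal_iff (cdf_nonneg μ y)]
  unfold quantileFun
  rw [hset]
  have hbdd : BddBelow {x : ℝ | t ≤ cdf μ x} := by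
    have h := (tendsto_cdf_atBot μ).eventually (gt_mem_nhds ht.1)
    obtain ⟨b, hb⟩ := h.exists
    refine ⟨b, fun y hy => ?_⟩
    by_contra hlt
    push Not at hlt
    have := monotone_cdf μ hlt.le
    have hy' : t ≤ cdf μ y := hy
    linarith
  have hne : {x : ℝ | t ≤ cdf μ x}.Nonempty := by
    have h := (tendsto_cdf_atTop μ).eventually (lt_mem_nhds ht.2)
    obtain ⟨b, hb⟩ := h.exists
    exact ⟨b, hb.le⟩
  constructor
  · intro h
    have hr : Tendsto (cdf μ) (𝓝[>] x) (𝓝 (cdf μ x)) :=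
      ((cdf μ).right_continuous x).mono_left (nhdsWithin_mono _ Set.Ioi_subset_Ici_self)
    refine ge_of_tendsto hr ?_
    filter_upwards [self_mem_nhdsWithin] with y hy
    obtain ⟨z, hz, hzy⟩ := exists_lt_of_csInf_lt hne (lt_of_le_of_lt h hy)
    exact le_trans hz (monotone_cdf μ hzy.le)
  · intro h
    exact csInf_le hbdd h

lemma G_mono (μ : Measure ℝ) [IsProbabilityMeasure μ] {s t : ℝ} (hs : s ∈ Set.Ioo (0 : ℝ) 1)
    (ht : t ∈ Set.Ioo (0 : ℝ) 1) (hst : s ≤ t) : G μ s ≤ G μ t := by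
  rw [G_le_iff μ hs]
  exact hst.trans ((G_le_iff μ ht _).1 le_rfl)

lemma measurable_G_joint {Ω : Type*} [MeasurableSpace Ω] (Y : Ω → Measure ℝ)
    [∀ ω, IsProbabilityMeasure (Y ω)] (h : ∀ x, Measurable fun ω => Y ω (Set.Iic x)) :
    Measurable fun p : Ω × ℝ => G (Y p.1) p.2 := by
  apply measurable_of_Iic
  intro x
  have hc : Measurable fun ω => cdf (Y ω) x := by
    have : (fun ω => cdf (Y ω) x) = fun ω => (Y ω (Set.Iic x)).toReal := by
      ext ω
      rw [cdf_eq_real]; rfl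
    rw [this]
    exact (h x).ennreal_toReal
  have h1 : MeasurableSet {p : Ω × ℝ | p.2 ∈ Set.Ioo (0 : ℝ) 1} :=
    measurable_snd measurableSet_Ioo
  have h2 : MeasurableSet {p : Ω × ℝ | p.2 ≤ cdf (Y p.1) x} :=
    measurableSet_le measurable_snd (hc.comp measurable_fst)
  have h3 : MeasurableSet {p : Ω × ℝ | (0 : ℝ) ≤ x} := MeasurableSet.const _
  have : (fun p : Ω × ℝ => G (Y p.1) p.2) ⁻¹' Set.Iic x =
      ({p : Ω × ℝ | p.2 ∈ Set.Ioo (0 : ℝ) 1} ∩ {p : Ω × ℝ | p.2 ≤ cdf (Y p.1) x}) ∪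
      ({p : Ω × ℝ | p.2 ∈ Set.Ioo (0 : ℝ) 1}ᶜ ∩ {p : Ω × ℝ | (0 : ℝ) ≤ x}) := by
    ext p
    by_cases hp : p.2 ∈ Set.Ioo (0 : ℝ) 1
    · have := G_le_iff (Y p.1) hp x
      simp only [Set.mem_preimage, Set.mem_Iic, Set.mem_union, Set.mem_inter_iff,
        Set.mem_ofPred_eq, Set.mem_compl_iff, hp]
      tauto
    · have h0 : G (Y p.1) p.2 = 0 := by simp only [G, if_neg hp]
      simp only [Set.mem_preimage, Set.mem_Iic, Set.mem_union, Set.mem_inter_iff,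
        Set.mem_ofPred_eq, Set.mem_compl_iff, hp, h0]
      tauto
  rw [this]
  exact (h1.inter h2).union (h1.compl.inter h3)

lemma measurable_G (μ : Measure ℝ) [IsProbabilityMeasure μ] : Measurable (G μ) := by
  have := measurable_G_joint (Ω := Unit) (fun _ => μ) (fun _ => measurable_const)
  exact this.comp (measurable_const.prodMk measurable_id : Measurable fun t : ℝ => ((), t))

lemma vol_seg {c : ℝ} (h1 : c ≤ 1) (S : Set ℝ)
    (hS : ∀ t ∈ Set.Ioo (0 : ℝ) 1, t ∈ S ↔ t ≤ c) : lam S = ENNReal.ofReal c := by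
  have : lam S = lam (Set.Ioc 0 c) := by
    apply measure_congr
    filter_upwards [ae_restrict_mem measurableSet_Ioo] with t ht
    apply propext
    have := hS t ht
    change t ∈ S ↔ t ∈ Set.Ioc 0 c
    rw [this]
    exact ⟨fun h => ⟨ht.1, h⟩, fun h => h.2⟩
  rw [this]
  apply le_antisymm
  · refine (Measure.restrict_apply_le _ _).trans ?_
    simp
  · rw [Measure.restrict_apply measurableSet_Ioc]
    calc ENNReal.ofReal c = volume (Set.Ioo 0 c) := by simp
      _ ≤ volume (Set.Ioc 0 c ∩ Set.Ioo 0 1) :=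
        measure_mono fun t ht => ⟨⟨ht.1, ht.2.le⟩, ht.1, ht.2.trans_le h1⟩

lemma lam_G_le (μ : Measure ℝ) [IsProbabilityMeasure μ] (x : ℝ) :
    lam {t | G μ t ≤ x} = μ (Set.Iic x) := by
  rw [← ofReal_cdf μ x]
  exact vol_seg (cdf_le_one μ x) _ (fun t ht => G_le_iff μ ht x)

lemma map_G (μ : Measure ℝ) [IsProbabilityMeasure μ] : lam.map (G μ) = μ := by
  have : IsProbabilityMeasure (lam.map (G μ)) :=
    Measure.isProbabilityMeasure_map (measurable_G μ).aemeasurable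
  apply Measure.ext_of_Iic
  intro x
  rw [Measure.map_apply (measurable_G μ) measurableSet_Iic]
  exact lam_G_le μ x

/-- comonotone event -/
lemma lam_diff (μ ν : Measure ℝ) [IsProbabilityMeasure μ] [IsProbabilityMeasure ν] (m M : ℝ) :
    lam {t | G ν t ≤ m ∧ M < G μ t} = ν (Set.Iic m) - μ (Set.Iic M) := by
  have hE : {t | G ν t ≤ m ∧ M < G μ t} = {t | G ν t ≤ m} \ {t | G μ t ≤ M} := by
    ext t; simp
  have hmB : MeasurableSet {t | G μ t ≤ M} := measurable_G μ measurableSet_Iic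
  rw [hE, ← lam_G_le ν m, ← lam_G_le μ M]
  rcases le_total (cdf ν m) (cdf μ M) with h | h
  · have hz : lam ({t | G ν t ≤ m} \ {t | G μ t ≤ M}) = 0 := by
      rw [measure_eq_zero_iff_ae_notMem]
      filter_upwards [ae_restrict_mem measurableSet_Ioo] with t ht hh
      exact hh.2 ((G_le_iff μ ht M).2 (((G_le_iff ν ht m).1 hh.1).trans h))
    rw [hz, lam_G_le, lam_G_le, ← ofReal_cdf, ← ofReal_cdf, tsub_eq_zero_of_le]
    exact ENNReal.ofReal_le_ofReal h
  · apply measure_sdiff' _ hmB.nullMeasurableSet (measure_ne_top _ _) |>.trans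
    congr 1
    apply measure_congr
    filter_upwards [ae_restrict_mem measurableSet_Ioo] with t ht
    apply propext
    change (t ∈ {t | G ν t ≤ m} ∪ {t | G μ t ≤ M}) ↔ t ∈ {t | G ν t ≤ m}
    constructor
    · rintro (h' | h')
      · exact h'
      · exact (G_le_iff ν ht m).2 (((G_le_iff μ ht M).1 h').trans h)
    · exact fun h' => Or.inl h'

lemma sq_layer (x y : ℝ) : ENNReal.ofReal (x - y) ^ 2 =
    ∫⁻ p : ℝ × ℝ, ({z : ℝ × ℝ | y ≤ min z.1 z.2 ∧ max z.1 z.2 < x}.indicator 1 p) := by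
  have : {z : ℝ × ℝ | y ≤ min z.1 z.2 ∧ max z.1 z.2 < x} = Set.Ico y x ×ˢ Set.Ico y x := by
    ext z; simp [Set.mem_prod]; tauto
  rw [this, lintegral_indicator_one (measurableSet_Ico.prod measurableSet_Ico),
    Measure.volume_eq_prod, Measure.prod_prod]
  simp [sq]

lemma sq_split (x y : ℝ) : ENNReal.ofReal ((x - y) ^ 2) =
    ENNReal.ofReal (x - y) ^ 2 + ENNReal.ofReal (y - x) ^ 2 := by
  rcases le_total x y with h | h
  · rw [ENNReal.ofReal_of_nonpos (by linarith : x - y ≤ 0), ← ENNReal.ofReal_pow (by linarith)]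
    simp only [ne_eq, OfNat.ofNat_ne_zero, not_false_eq_true, zero_pow, zero_add]
    congr 1; ring
  · rw [ENNReal.ofReal_of_nonpos (by linarith : y - x ≤ 0), ← ENNReal.ofReal_pow (by linarith)]
    simp

/-- Layer-cake with Tonelli. -/
lemma layer {α : Type*} [MeasurableSpace α] (γ : Measure α) [SFinite γ] {X Y : α → ℝ}
    (hX : Measurable X) (hY : Measurable Y) :
    ∫⁻ a, ENNReal.ofReal (X a - Y a) ^ 2 ∂γ =
      ∫⁻ p : ℝ × ℝ, γ {a | Y a ≤ min p.1 p.2 ∧ max p.1 p.2 < X a} := by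
  have hm : MeasurableSet {q : α × (ℝ × ℝ) | Y q.1 ≤ min q.2.1 q.2.2 ∧ max q.2.1 q.2.2 < X q.1} := by
    exact (measurableSet_le (f := fun q : α × (ℝ × ℝ) => Y q.1) (g := fun q => min q.2.1 q.2.2)
      (by fun_prop) (by fun_prop)).inter
      (measurableSet_lt (f := fun q : α × (ℝ × ℝ) => max q.2.1 q.2.2) (g := fun q => X q.1)
      (by fun_prop) (by fun_prop))
  simp_rw [sq_layer]
  rw [lintegral_lintegral_swap]
  · apply lintegral_congr
    intro p
    have hs : MeasurableSet {a | Y a ≤ min p.1 p.2 ∧ max p.1 p.2 < X a} := by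
      exact (hY measurableSet_Iic).inter (hX measurableSet_Ioi)
    rw [← lintegral_indicator_one hs]
    rfl
  · exact ((measurable_one.indicator hm :
      Measurable (Set.indicator _ (1 : α × (ℝ × ℝ) → ENNReal)))).aemeasurable

lemma half_lower (μ ν : Measure ℝ) [IsProbabilityMeasure μ] [IsProbabilityMeasure ν]
    {α : Type*} [MeasurableSpace α] (γ : Measure α) [IsProbabilityMeasure γ] {X Y : α → ℝ}
    (hX : Measurable X) (hY : Measurable Y) (hμ : γ.map X = μ) (hν : γ.map Y = ν) :
    ∫⁻ t, ENNReal.ofReal (G μ t - G ν t) ^ 2 ∂lam ≤ ∫⁻ a, ENNReal.ofReal (X a - Y a) ^ 2 ∂γ := by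
  rw [layer γ hX hY, layer lam (measurable_G μ) (measurable_G ν)]
  apply lintegral_mono
  intro p
  simp only
  rw [lam_diff, ← hμ, ← hν, Measure.map_apply hX measurableSet_Iic,
    Measure.map_apply hY measurableSet_Iic]
  refine le_measure_sdiff.trans (measure_mono ?_)
  rintro a ⟨h1, h2⟩
  exact ⟨h1, not_le.1 h2⟩

lemma lower (μ ν : Measure ℝ) [IsProbabilityMeasure μ] [IsProbabilityMeasure ν]
    (γ : Measure (ℝ × ℝ)) [IsProbabilityMeasure γ] (hμ : γ.fst = μ) (hν : γ.snd = ν) :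
    ∫⁻ t, ENNReal.ofReal ((G μ t - G ν t) ^ 2) ∂lam ≤
      ∫⁻ p, ENNReal.ofReal ((p.1 - p.2) ^ 2) ∂γ := by
  simp_rw [sq_split]
  have := measurable_G μ
  have := measurable_G ν
  rw [lintegral_add_left (by fun_prop), lintegral_add_left (by fun_prop)]
  exact add_le_add (half_lower μ ν γ measurable_fst measurable_snd hμ hν)
    (half_lower ν μ γ measurable_snd measurable_fst hν hμ)

lemma G_sq (μ : Measure ℝ) [IsProbabilityMeasure μ] :
    ∫⁻ t, ENNReal.ofReal (G μ t ^ 2) ∂lam = ∫⁻ x, ENNReal.ofReal (x ^ 2) ∂μ := by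
  conv_rhs => rw [← map_G μ]
  rw [lintegral_map (by fun_prop) (measurable_G μ)]

lemma memLp_of {α : Type*} [MeasurableSpace α] {γ : Measure α} {f : α → ℝ} (hf : AEStronglyMeasurable f γ)
    (h : ∫⁻ a, ENNReal.ofReal (f a ^ 2) ∂γ < ⊤) : MemLp f 2 γ := by
  rw [memLp_two_iff_integrable_sq hf]
  refine ⟨hf.pow 2, ?_⟩
  rw [hasFiniteIntegral_iff_ofReal (Eventually.of_forall fun a => sq_nonneg _)]
  exact h

lemma memLp_G (μ : Measure ℝ) [IsProbabilityMeasure μ]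
    (h : ∫⁻ x, ENNReal.ofReal (x ^ 2) ∂μ < ⊤) : MemLp (G μ) 2 lam :=
  memLp_of (measurable_G μ).aestronglyMeasurable (by rwa [G_sq])

lemma w2_eq (μ ν : Measure ℝ) [IsProbabilityMeasure μ] [IsProbabilityMeasure ν]
    (hμ : ∫⁻ x, ENNReal.ofReal (x ^ 2) ∂μ < ⊤) (hν : ∫⁻ x, ENNReal.ofReal (x ^ 2) ∂ν < ⊤) :
    wasserstein2Sq μ ν = ∫ t, (G μ t - G ν t) ^ 2 ∂lam := by
  have mμ := measurable_G μ
  have mν := measurable_G ν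
  apply IsLeast.csInf_eq
  constructor
  · refine ⟨lam.map fun t => (G μ t, G ν t),
      Measure.isProbabilityMeasure_map (by fun_prop), ?_, ?_, ?_⟩
    · rw [Measure.fst_map_prodMk mν, map_G]
    · rw [Measure.snd_map_prodMk mμ, map_G]
    · rw [integral_map (by fun_prop) (by fun_prop)]
  · rintro c ⟨γ, hγ, h1, h2, rfl⟩
    have m1 : MemLp (fun p : ℝ × ℝ => p.1) 2 γ := by
      apply memLp_of (by fun_prop)
      rw [← h1, Measure.fst, lintegral_map (by fun_prop) (by fun_prop)] at hμ
      exact hμ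
    have m2 : MemLp (fun p : ℝ × ℝ => p.2) 2 γ := by
      apply memLp_of (by fun_prop)
      rw [← h2, Measure.snd, lintegral_map (by fun_prop) (by fun_prop)] at hν
      exact hν
    have hi : Integrable (fun p : ℝ × ℝ => (p.1 - p.2) ^ 2) γ := (m1.sub m2).integrable_sq
    rw [integral_eq_lintegral_of_nonneg_ae (Eventually.of_forall fun a => sq_nonneg _)
      (by fun_prop), integral_eq_lintegral_of_nonneg_ae (Eventually.of_forall fun a => sq_nonneg _)
      (by fun_prop)]
    refine ENNReal.toReal_mono ?_ (lower μ ν γ h1 h2)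
    exact ((hasFiniteIntegral_iff_ofReal (Eventually.of_forall fun a => sq_nonneg _)).1 hi.2).ne

lemma meas_eval (x : ℝ) :
    @Measurable (ProbabilityMeasure ℝ) ENNReal (borel _) _
      (fun μ : ProbabilityMeasure ℝ => (μ : Measure ℝ) (Set.Iic x)) := by
  let : MeasurableSpace (ProbabilityMeasure ℝ) := borel _
  have : BorelSpace (ProbabilityMeasure ℝ) := ⟨rfl⟩
  apply UpperSemicontinuous.measurable
  intro μ y hy
  exact eventually_lt_of_limsup_lt (lt_of_le_of_lt
    (ProbabilityMeasure.limsup_measure_closed_le_of_tendsto (L := 𝓝 μ) (μs := id) tendsto_id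
      isClosed_Iic) hy)

/-- The quantile function of the law of a monotone function. -/
lemma quantile_of_mono (q : ℝ → ℝ) (hq : Measurable q) (hm : MonotoneOn q (Set.Ioo 0 1)) :
    G (lam.map q) =ᵐ[lam] q := by
  have : IsProbabilityMeasure (lam.map q) := Measure.isProbabilityMeasure_map hq.aemeasurable
  have hne : ∀ᵐ t ∂lam, ∀ r : ℚ, t ≠ cdf (lam.map q) r := by
    rw [ae_all_iff]
    intro r
    exact Measure.ae_ne _ _
  filter_upwards [hne, ae_restrict_mem measurableSet_Ioo] with t hne ht
  have key : ∀ r : ℚ, q t ≤ r ↔ G (lam.map q) t ≤ r := by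
    intro r
    rw [G_le_iff _ ht]
    have hc : ENNReal.ofReal (cdf (lam.map q) r) = lam {s | q s ≤ r} := by
      rw [ofReal_cdf, Measure.map_apply hq measurableSet_Iic]; rfl
    constructor
    · intro h
      rw [← ENNReal.ofReal_le_ofReal_iff (cdf_nonneg _ _), hc, ← vol_seg ht.2.le (Set.Iic t)
        (fun s _ => Iff.rfl)]
      apply measure_mono_ae
      filter_upwards [ae_restrict_mem measurableSet_Ioo] with s hs hst
      exact (hm hs ht hst).trans h
    · intro h
      have hlt := lt_of_le_of_ne h (hne r)
      by_contra hqt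
      have : ENNReal.ofReal (cdf (lam.map q) r) ≤ ENNReal.ofReal t := by
        rw [hc, ← vol_seg ht.2.le (Set.Iic t) (fun s _ => Iff.rfl)]
        apply measure_mono_ae
        filter_upwards [ae_restrict_mem measurableSet_Ioo] with s hs hsr
        by_contra hst
        exact hqt ((hm ht hs (not_le.1 hst).le).trans hsr)
      rw [ENNReal.ofReal_le_ofReal_iff ht.1.le] at this
      linarith
  apply le_antisymm
  · exact le_of_forall_lt_rat_imp_le fun r hr => (key r).1 hr.le
  · exact le_of_forall_lt_rat_imp_le fun r hr => (key r).2 hr.le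

lemma bias_var {Ω : Type*} [MeasurableSpace Ω] (P : Measure Ω) [IsProbabilityMeasure P]
    {X : Ω → ℝ} (hX : MemLp X 2 P) (c : ℝ) :
    ∫ ω, (X ω - c) ^ 2 ∂P = ∫ ω, (X ω - ∫ ω', X ω' ∂P) ^ 2 ∂P + (∫ ω, X ω ∂P - c) ^ 2 := by
  set m := ∫ ω, X ω ∂P with hm
  have hi : Integrable X P := hX.integrable one_le_two
  have h1 : Integrable (fun ω => (X ω - m) ^ 2) P := (hX.sub (memLp_const m)).integrable_sq
  have h2 : Integrable (fun ω => 2 * (m - c) * (X ω - m)) P :=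
    (hi.sub (integrable_const m)).const_mul _
  have : ∀ ω, (X ω - c) ^ 2 = ((X ω - m) ^ 2 + 2 * (m - c) * (X ω - m)) + (m - c) ^ 2 := by
    intro ω; ring
  have h3 : Integrable (fun ω => (X ω - m) ^ 2 + 2 * (m - c) * (X ω - m)) P := h1.add h2
  simp_rw [this]
  rw [integral_add h3 (integrable_const _), integral_add h1 h2, integral_const_mul,
    integral_sub hi (integrable_const _)]
  simp [← hm]

end WB

/-- **Proposition 1, Assertion 1: existence and uniqueness of the 2-Wasserstein
barycenter of a distribution-valued random variable, and its quantile function.**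
Let `𝒴 : Ω → 𝒫(ℝ)` be a measurable map into the space of Borel probability measures on
`ℝ` (with the Borel σ-algebra of the topology of weak convergence), with
`E[∫ x² d𝒴] < ∞`. Then there is a Borel probability measure `μ*` on `ℝ` with finite
second moment whose quantile function is a.e. on `(0,1)` the expectation of the quantile
functions of `𝒴`, and which uniquely minimizes `ν ↦ E[W₂²(𝒴, ν)]` over probability
measures with finite second moment. -/
theorem wasserstein_barycenter_of_random_distribution
    {Ω : Type*} [MeasurableSpace Ω] (P : Measure Ω) [IsProbabilityMeasure P]
    (𝒴 : Ω → ProbabilityMeasure ℝ)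
    (h𝒴meas : @Measurable Ω (ProbabilityMeasure ℝ) _ (borel (ProbabilityMeasure ℝ)) 𝒴)
    (hmom : ∫⁻ ω, ∫⁻ x, ENNReal.ofReal (x ^ 2) ∂(𝒴 ω : Measure ℝ) ∂P < ⊤) :
    ∃ μstar : Measure ℝ, IsProbabilityMeasure μstar ∧
      (∫⁻ x, ENNReal.ofReal (x ^ 2) ∂μstar < ⊤) ∧
      (∀ᵐ t ∂(volume.restrict (Set.Ioo (0 : ℝ) 1)),
        quantileFun μstar t = ∫ ω, quantileFun (𝒴 ω : Measure ℝ) t ∂P) ∧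
      (∀ ν : Measure ℝ, IsProbabilityMeasure ν →
        (∫⁻ x, ENNReal.ofReal (x ^ 2) ∂ν < ⊤) →
          (∫ ω, wasserstein2Sq (𝒴 ω : Measure ℝ) μstar ∂P
              ≤ ∫ ω, wasserstein2Sq (𝒴 ω : Measure ℝ) ν ∂P) ∧
          (∫ ω, wasserstein2Sq (𝒴 ω : Measure ℝ) ν ∂P
              = ∫ ω, wasserstein2Sq (𝒴 ω : Measure ℝ) μstar ∂P ↔ ν = μstar)) := by
  classical
  have hY : ∀ x, Measurable fun ω => (𝒴 ω : Measure ℝ) (Set.Iic x) :=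
    fun x => (WB.meas_eval x).comp h𝒴meas
  have hf := WB.measurable_G_joint (fun ω => (𝒴 ω : Measure ℝ)) hY
  set f : Ω × ℝ → ℝ := fun p => WB.G (𝒴 p.1 : Measure ℝ) p.2 with hfdef
  have hfL : MemLp f 2 (P.prod WB.lam) := by
    apply WB.memLp_of hf.aestronglyMeasurable
    rw [lintegral_prod _ (by fun_prop)]
    simp only [hfdef, WB.G_sq]
    exact hmom
  have hfsq : Integrable (fun p => f p ^ 2) (P.prod WB.lam) := hfL.integrable_sq
  -- sections
  have hsec : ∀ t, Measurable fun ω => f (ω, t) := fun t => by fun_prop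
  have hsecL : ∀ᵐ t ∂WB.lam, MemLp (fun ω => f (ω, t)) 2 P := by
    filter_upwards [hfsq.prod_left_ae] with t ht
    exact (memLp_two_iff_integrable_sq (hsec t).aestronglyMeasurable).2 ht
  -- good points are dense
  have hex : ∀ a b : ℝ, 0 ≤ a → a < b → b ≤ 1 →
      ∃ s ∈ Set.Ioo a b, Integrable (fun ω => f (ω, s)) P := by
    intro a b ha hab hb
    by_contra hcon
    push Not at hcon
    have h0 : volume (Set.Ioo a b) = 0 := by
      rw [measure_eq_zero_iff_ae_notMem]
      have := (ae_restrict_iff' measurableSet_Ioo).1 hsecL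
      filter_upwards [this] with t ht hmem
      exact hcon t hmem ((ht ⟨ha.trans_lt hmem.1, hmem.2.trans_le hb⟩).integrable one_le_two)
    rw [Real.volume_Ioo, ENNReal.ofReal_eq_zero] at h0
    linarith
  have hint : ∀ t ∈ Set.Ioo (0 : ℝ) 1, Integrable (fun ω => f (ω, t)) P := by
    intro t ht
    obtain ⟨s, hs, hsi⟩ := hex 0 t le_rfl ht.1 ht.2.le
    obtain ⟨r, hr, hri⟩ := hex t 1 ht.1.le ht.2 le_rfl
    refine (hsi.abs.add hri.abs).mono' (hsec t).aestronglyMeasurable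
      (Filter.Eventually.of_forall fun ω => ?_)
    have h1 : f (ω, s) ≤ f (ω, t) := WB.G_mono _ ⟨hs.1, hs.2.trans ht.2⟩ ht hs.2.le
    have h2 : f (ω, t) ≤ f (ω, r) := WB.G_mono _ ht ⟨ht.1.trans hr.1, hr.2⟩ hr.1.le
    simp only [Pi.add_apply, Real.norm_eq_abs]
    rw [abs_le]
    constructor
    · have := neg_abs_le (f (ω, s)); have := abs_nonneg (f (ω, r)); linarith
    · have := le_abs_self (f (ω, r)); have := abs_nonneg (f (ω, s)); linarith
  set q : ℝ → ℝ := fun t => ∫ ω, f (ω, t) ∂P with hq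
  have hqm : Measurable q := (hf.stronglyMeasurable.integral_prod_left').measurable
  have hqmono : MonotoneOn q (Set.Ioo 0 1) := by
    intro s hs t ht hst
    exact integral_mono (hint s hs) (hint t ht) fun ω => WB.G_mono _ hs ht hst
  have hqL : MemLp q 2 WB.lam := by
    rw [memLp_two_iff_integrable_sq hqm.aestronglyMeasurable]
    refine hfsq.integral_prod_right.mono' (by fun_prop) ?_
    filter_upwards [hsecL] with t ht
    have := WB.bias_var P ht 0
    simp only [sub_zero] at this
    rw [this, Real.norm_of_nonneg (sq_nonneg _)]
    have : 0 ≤ ∫ ω, (f (ω, t) - ∫ ω', f (ω', t) ∂P) ^ 2 ∂P :=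
      integral_nonneg fun ω => sq_nonneg _
    simp only [hq]
    linarith
  have hprob : IsProbabilityMeasure (WB.lam.map q) :=
    Measure.isProbabilityMeasure_map hqm.aemeasurable
  have hGq := WB.quantile_of_mono q hqm hqmono
  have hsec2 : ∫⁻ x, ENNReal.ofReal (x ^ 2) ∂(WB.lam.map q) < ⊤ := by
    rw [lintegral_map (by fun_prop) hqm]
    exact (hasFiniteIntegral_iff_ofReal (Filter.Eventually.of_forall fun a => sq_nonneg _)).1
      hqL.integrable_sq.2
  -- moments of 𝒴 are a.s. finite
  have hae : ∀ᵐ ω ∂P, ∫⁻ x, ENNReal.ofReal (x ^ 2) ∂(𝒴 ω : Measure ℝ) < ⊤ := by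
    have hm : Measurable fun ω => ∫⁻ t, ENNReal.ofReal (f (ω, t) ^ 2) ∂WB.lam :=
      Measurable.lintegral_prod_right' (f := fun p => ENNReal.ofReal (f p ^ 2)) (by fun_prop)
    simp only [hfdef, WB.G_sq] at hm
    exact ae_lt_top hm hmom.ne
  have hprodI : ∀ h : ℝ → ℝ, MemLp h 2 WB.lam →
      Integrable (fun p : Ω × ℝ => (f p - h p.2) ^ 2) (P.prod WB.lam) := by
    intro h hh
    exact (hfL.sub (hh.comp_snd P)).integrable_sq
  have hW : ∀ ν : Measure ℝ, IsProbabilityMeasure ν → (∫⁻ x, ENNReal.ofReal (x ^ 2) ∂ν < ⊤) →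
      ∫ ω, wasserstein2Sq (𝒴 ω : Measure ℝ) ν ∂P =
        (∫ t, ∫ ω, (f (ω, t) - q t) ^ 2 ∂P ∂WB.lam) + ∫ t, (q t - WB.G ν t) ^ 2 ∂WB.lam := by
    intro ν hν hν2
    have hGL := WB.memLp_G ν hν2
    have e1 : ∫ ω, wasserstein2Sq (𝒴 ω : Measure ℝ) ν ∂P =
        ∫ ω, ∫ t, (f (ω, t) - WB.G ν t) ^ 2 ∂WB.lam ∂P := by
      apply integral_congr_ae
      filter_upwards [hae] with ω hω
      exact WB.w2_eq _ _ hω hν2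
    have i1 : Integrable (fun t => ∫ ω, (f (ω, t) - q t) ^ 2 ∂P) WB.lam :=
      (hprodI _ hqL).integral_prod_right
    have i2 : Integrable (fun t => (q t - WB.G ν t) ^ 2) WB.lam := (hqL.sub hGL).integrable_sq
    rw [e1, integral_integral_swap (f := fun ω t => (f (ω, t) - WB.G ν t) ^ 2) (hprodI _ hGL),
      ← integral_add i1 i2]
    apply integral_congr_ae
    filter_upwards [hsecL] with t ht
    exact WB.bias_var P ht _
  have hz : ∫ t, (q t - WB.G (WB.lam.map q) t) ^ 2 ∂WB.lam = 0 := by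
    rw [integral_eq_zero_of_ae]
    filter_upwards [hGq] with t ht
    simp [ht]
  refine ⟨WB.lam.map q, hprob, hsec2, ?_, ?_⟩
  · filter_upwards [hGq, ae_restrict_mem measurableSet_Ioo] with t h1 h2
    rw [← WB.G_eq h2, h1]
    simp only [hq, hfdef]
    exact integral_congr_ae (Filter.Eventually.of_forall fun ω => WB.G_eq h2)
  · intro ν hν hν2
    rw [hW ν hν hν2, hW _ hprob hsec2, hz, add_zero]
    refine ⟨le_add_of_nonneg_right (integral_nonneg fun t => sq_nonneg _), ?_⟩
    rw [add_eq_left]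
    constructor
    · intro h0
      have hGL := WB.memLp_G ν hν2
      have i2 : Integrable (fun t => (q t - WB.G ν t) ^ 2) WB.lam := (hqL.sub hGL).integrable_sq
      rw [integral_eq_zero_iff_of_nonneg (fun t => sq_nonneg _) i2] at h0
      have hqν : WB.G ν =ᵐ[WB.lam] q := by
        filter_upwards [h0] with t ht
        simp only [Pi.zero_apply, ne_eq, OfNat.ofNat_ne_zero, not_false_eq_true,
          pow_eq_zero_iff] at ht
        linarith
      rw [← Measure.map_congr hqν, WB.map_G]
    · rintro rfl
      exact hz
end

section
/- Assume: (consistency) 1_A • Z = 1_A • Z_d P-almost surely; (ignorability) Z_d and the indicator 1_A are conditionally independent given 𝔪; (overlap) π > 0 P-almost surely. Then π⁻¹ • E[1_A • Z | 𝔪] = E[Z_d | 𝔪] P-almost surely, and consequently E[Z_d] = E[π⁻¹ • E[1_A • Z | 𝔪]]. In particular, the causal map Δ_d = E[Z_d] equals E[m_d], where m_d := π⁻¹ • E[1_A • Z | 𝔪] is the outcome regression, so Δ_d is identifiable from the observed data. -/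
open MeasureTheory ProbabilityTheory

theorem causal_aux
    {Ω : Type*} (𝔪 : MeasurableSpace Ω) {mΩ : MeasurableSpace Ω} [StandardBorelSpace Ω]
    (P : Measure Ω) [IsProbabilityMeasure P]
    {H : Type*} [NormedAddCommGroup H] [InnerProductSpace ℝ H] [CompleteSpace H]
    [SecondCountableTopology H] [MeasurableSpace H] [BorelSpace H]
    (h𝔪 : 𝔪 ≤ mΩ)
    (A : Set Ω) (hA : MeasurableSet[mΩ] A)
    (Z Zd : Ω → H)
    (hZmeas : StronglyMeasurable[mΩ] Z) (hZdmeas : StronglyMeasurable[mΩ] Zd)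
    (hZint : Integrable Z P) (hZdint : Integrable Zd P)
    (π : Ω → ℝ) (hπmeas : Measurable[𝔪] π)
    (hπver : π =ᵐ[P] P[A.indicator (fun _ => (1 : ℝ)) | 𝔪])
    (hconsistency : A.indicator Z =ᵐ[P] A.indicator Zd)
    (hignorability : CondIndepFun 𝔪 h𝔪 Zd (A.indicator (fun _ => (1 : ℝ))) P)
    (hoverlap : ∀ᵐ ω ∂P, 0 < π ω) :
    ((fun ω => (π ω)⁻¹ • (P[A.indicator Z | 𝔪]) ω) =ᵐ[P] P[Zd | 𝔪]) ∧
    (∫ ω, Zd ω ∂P = ∫ ω, (π ω)⁻¹ • (P[A.indicator Z | 𝔪]) ω ∂P) := by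
  have hZdm : Measurable Zd := hZdmeas.measurable
  set C : Set (Set H) := generateSetAlgebra (MeasurableSpace.countableGeneratingSet H) with hC
  have hCc : C.Countable :=
    countable_generateSetAlgebra (MeasurableSpace.countable_countableGeneratingSet)
  have hCgen : MeasurableSpace.generateFrom C = ‹MeasurableSpace H› := by
    rw [hC, generateFrom_generateSetAlgebra_eq,
      MeasurableSpace.generateFrom_countableGeneratingSet]
  have hCm : ∀ s ∈ C, MeasurableSet s := fun s hs => by
    rw [← hCgen]; exact MeasurableSpace.measurableSet_generateFrom hs
  have hCpi : IsPiSystem C := by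
    intro s hs t ht _
    exact isSetAlgebra_generateSetAlgebra.inter_mem hs ht
  -- pathwise independence
  have hind : ∀ᵐ ω ∂P, ∀ s ∈ C, condExpKernel P 𝔪 ω (Zd ⁻¹' s ∩ A)
      = condExpKernel P 𝔪 ω (Zd ⁻¹' s) * condExpKernel P 𝔪 ω A := by
    rw [ae_ball_iff hCc]
    intro s hs
    have h := Kernel.IndepFun.measure_inter_preimage_eq_mul hignorability s {1} (hCm s hs)
      (measurableSet_singleton _)
    have hpre : (A.indicator (fun _ => (1 : ℝ))) ⁻¹' {1} = A := by
      ext x; by_cases hx : x ∈ A <;> simp [hx]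
    rw [hpre] at h
    exact ae_of_ae_trim h𝔪 h
  have hmain : ∀ᵐ ω ∂P, ∫ y, A.indicator Zd y ∂(condExpKernel P 𝔪 ω)
      = (condExpKernel P 𝔪 ω).real A • ∫ y, Zd y ∂(condExpKernel P 𝔪 ω) := by
    filter_upwards [hind] with ω hω
    have hle : MeasurableSpace.generateFrom {A} ≤ mΩ :=
      MeasurableSpace.generateFrom_le (by simpa using hA)
    have hI : Indep (MeasurableSpace.generateFrom {A})
        (MeasurableSpace.comap Zd inferInstance) (condExpKernel P 𝔪 ω) := by
      refine IndepSets.indep hle hZdm.comap_le (IsPiSystem.singleton A) (hCpi.comap Zd) rfl ?_ ?_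
      · conv_lhs => rw [← hCgen]
        rw [MeasurableSpace.comap_generateFrom]; rfl
      · rw [IndepSets_iff]
        rintro t1 t2 rfl ⟨s, hs, rfl⟩
        rw [Set.inter_comm, hω s hs, mul_comm]
    rw [integral_indicator hA]
    exact hI.setIntegral_eq_smul hle hZdm.aemeasurable
      (MeasurableSpace.measurableSet_generateFrom rfl) (f := id)
      stronglyMeasurable_id.aestronglyMeasurable
  have h1 : (fun ω => (π ω)⁻¹ • (P[A.indicator Z | 𝔪]) ω) =ᵐ[P] P[Zd | 𝔪] := by
    filter_upwards [condExp_congr_ae (m := 𝔪) hconsistency,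
      condExp_ae_eq_integral_condExpKernel h𝔪 (hZdint.indicator hA),
      condExp_ae_eq_integral_condExpKernel h𝔪 hZdint,
      condExpKernel_ae_eq_condExp (μ := P) h𝔪 hA, hπver, hoverlap, hmain]
      with ω a1 a2 a3 a4 a5 a6 a7
    rw [a1, a2, a3, a7, a4, ← a5, smul_smul, inv_mul_cancel₀ a6.ne', one_smul]
  exact ⟨h1, by rw [integral_congr_ae h1, integral_condExp h𝔪]⟩

/-- **Lemma C.1 / Proposition 1, Assertion 2: identification of the causal map via the
outcome regression.** Under consistency (`1_A • Z = 1_A • Z_d` a.s.), ignorability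
(`Z_d ⟂⟂ 1_A | 𝔪`) and overlap (`π > 0` a.s., where `π = E[1_A | 𝔪]`), one has
`π⁻¹ • E[1_A • Z | 𝔪] = E[Z_d | 𝔪]` a.s. and hence
`E[Z_d] = E[π⁻¹ • E[1_A • Z | 𝔪]]`: the causal map `Δ_d = E[Z_d]` equals `E[m_d]` and
is identifiable from the observed data. -/
theorem causal_map_identification_direct_regression
    {Ω : Type*} [mΩ : MeasurableSpace Ω] [StandardBorelSpace Ω]
    (P : Measure Ω) [IsProbabilityMeasure P]
    {H : Type*} [NormedAddCommGroup H] [InnerProductSpace ℝ H] [CompleteSpace H]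
    [SecondCountableTopology H] [MeasurableSpace H] [BorelSpace H]
    (𝔪 : MeasurableSpace Ω) (h𝔪 : 𝔪 ≤ mΩ)
    (A : Set Ω) (hA : MeasurableSet[mΩ] A)
    (Z Zd : Ω → H)
    (hZmeas : StronglyMeasurable[mΩ] Z) (hZdmeas : StronglyMeasurable[mΩ] Zd)
    (hZint : Integrable Z P) (hZdint : Integrable Zd P)
    (π : Ω → ℝ) (hπmeas : Measurable[𝔪] π)
    (hπver : π =ᵐ[P] P[A.indicator (fun _ => (1 : ℝ)) | 𝔪])
    (hconsistency : A.indicator Z =ᵐ[P] A.indicator Zd)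
    (hignorability : CondIndepFun 𝔪 h𝔪 Zd (A.indicator (fun _ => (1 : ℝ))) P)
    (hoverlap : ∀ᵐ ω ∂P, 0 < π ω) :
    ((fun ω => (π ω)⁻¹ • (P[A.indicator Z | 𝔪]) ω) =ᵐ[P] P[Zd | 𝔪]) ∧
    (∫ ω, Zd ω ∂P = ∫ ω, (π ω)⁻¹ • (P[A.indicator Z | 𝔪]) ω ∂P) := by
  exact causal_aux 𝔪 P h𝔪 A hA Z Zd hZmeas hZdmeas hZint hZdint π hπmeas hπver
    hconsistency hignorability hoverlap
end
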